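/- There is a universal constant C such that for every even n and every t > 0, |P(W_n ≤ t) − P(Z ≤ t)| ≤ C·max(1, t^{1/2})/√n, where W_n takes the value W(i) := (n − 2i)(n + 2 − 2i)/(2n) with probability π(i), π(i) = (C(n,i) − C(n,i−1))/C(n, n/2) for 1 ≤ i ≤ n/2, π(0) = 1/C(n, n/2), and Z ~ Exp(1). -/

import Mathlib

open Finset Filter

/-- The probability that the spectral measure puts on eigenvalue index `i`. -/
noncomputable def piBL (n i : ℕ) : ℝ :=
  if i = 0 then 1 / (n.choose (n / 2) : ℝ)
  else ((n.choose i : ℝ) - (n.choose (i - 1) : ℝ)) / (n.choose (n / 2) : ℝ)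

/-- The rescaled eigenvalue `W(i) = (n-2i)(n+2-2i)/(2n)`. -/
noncomputable def WBL (n i : ℕ) : ℝ :=
  ((n : ℝ) - 2 * i) * ((n : ℝ) + 2 - 2 * i) / (2 * n)

/-- `P(W_n ≤ t)` for the rescaled spectral measure of the Bernoulli-Laplace chain. -/
noncomputable def PBL (n : ℕ) (t : ℝ) : ℝ :=
  ∑ i ∈ Finset.range (n / 2 + 1), if WBL n i ≤ t then piBL n i else 0

/-- The ratio `C(2m, m-k) / C(2m, m)`, written as a product over `m`. -/
noncomputable def centralRatio (m k : ℕ) : ℝ :=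
  ∏ i ∈ Finset.range k, ((m : ℝ) - i) / (m + i + 1)

theorem centralRatio_succ (m k : ℕ) :
    centralRatio m (k + 1) = centralRatio m k * (((m : ℝ) - k) / (m + k + 1)) :=
  Finset.prod_range_succ _ _

theorem centralRatio_succ_self (m : ℕ) : centralRatio m (m + 1) = 0 := by
  simp [centralRatio_succ]

theorem centralRatio_nonneg {m k : ℕ} (hk : k ≤ m + 1) : 0 ≤ centralRatio m k := by
  refine Finset.prod_nonneg fun i hi => ?_
  have hi : (i : ℝ) ≤ m := by
    have := Finset.mem_range.1 hi
    exact_mod_cast (by omega : i ≤ m)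
  have : (0 : ℝ) ≤ m - i := by linarith
  positivity

theorem choose_sub_eq_centralRatio_mul {m k : ℕ} (hk : k ≤ m) :
    ((2 * m).choose (m - k) : ℝ) = centralRatio m k * (2 * m).choose m := by
  induction k with
  | zero => simp [centralRatio]
  | succ k ih =>
    have h := Nat.choose_succ_right_eq (2 * m) (m - (k + 1))
    rw [show m - (k + 1) + 1 = m - k by omega,
      show 2 * m - (m - (k + 1)) = m + k + 1 by omega] at h
    have h' : ((2 * m).choose (m - k) : ℝ) * ((m : ℝ) - k)
        = (2 * m).choose (m - (k + 1)) * (m + k + 1) := by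
      rw [← Nat.cast_sub (by omega : k ≤ m)]
      exact_mod_cast h
    rw [ih (by omega)] at h'
    rw [centralRatio_succ]
    have : (0 : ℝ) < m + k + 1 := by positivity
    field_simp
    linarith

theorem piBL_reflect {m j : ℕ} (hj : j ≤ m) :
    piBL (2 * m) (m - j) = centralRatio m j - centralRatio m (j + 1) := by
  have hc : (0 : ℝ) < (2 * m).choose m := by
    exact_mod_cast Nat.choose_pos (by omega)
  have hm : 2 * m / 2 = m := by omega
  rw [piBL, hm]
  have h := choose_sub_eq_centralRatio_mul hj
  split_ifs with h0
  · obtain rfl : j = m := by omega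
    rw [centralRatio_succ_self, div_eq_iff hc.ne']
    simpa using h
  · rw [show m - j - 1 = m - (j + 1) by omega, h,
      choose_sub_eq_centralRatio_mul (by omega : j + 1 ≤ m), div_eq_iff hc.ne']
    ring

theorem WBL_reflect {m j : ℕ} (hm : 0 < m) (hj : j ≤ m) :
    WBL (2 * m) (m - j) = (j : ℝ) * (j + 1) / m := by
  have : (0 : ℝ) < m := by exact_mod_cast hm
  rw [WBL, Nat.cast_sub hj]
  push_cast
  field_simp
  ring

theorem PBL_eq_one_sub_centralRatio {m k : ℕ} (hm : 0 < m) (hk : k ≤ m + 1) {t : ℝ}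
    (h : ∀ j ≤ m, (j : ℝ) * (j + 1) ≤ m * t ↔ j < k) :
    PBL (2 * m) t = 1 - centralRatio m k := by
  have hm' : (0 : ℝ) < m := by exact_mod_cast hm
  rw [PBL, show 2 * m / 2 = m by omega, ← Finset.sum_range_reflect]
  calc
    _ = ∑ j ∈ Finset.range (m + 1),
        if j < k then centralRatio m j - centralRatio m (j + 1) else 0 := by
      refine Finset.sum_congr rfl fun j hj => ?_
      have hj : j ≤ m := by
        have := Finset.mem_range.1 hj
        omega
      rw [show m + 1 - 1 - j = m - j by omega, WBL_reflect hm hj, piBL_reflect hj]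
      refine if_congr ?_ rfl rfl
      rw [div_le_iff₀ hm', mul_comm t, h j hj]
    _ = ∑ j ∈ Finset.range k, (centralRatio m j - centralRatio m (j + 1)) := by
      rw [← Finset.sum_filter]
      refine Finset.sum_congr ?_ fun _ _ => rfl
      ext j
      simp only [Finset.mem_filter, Finset.mem_range]
      omega
    _ = _ := by
      rw [Finset.sum_range_sub']
      simp [centralRatio]

theorem centralRatio_mul_le {m k : ℕ} (hk : k ≤ m + 1) :
    centralRatio m k * (m + (k : ℝ) ^ 2) ≤ m := by
  induction k with
  | zero => simp [centralRatio]
  | succ k ih =>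
    refine le_trans ?_ (ih (by omega))
    rw [centralRatio_succ, mul_assoc]
    refine mul_le_mul_of_nonneg_left ?_ (centralRatio_nonneg (by omega))
    have : (0 : ℝ) < m + k + 1 := by positivity
    rw [div_mul_eq_mul_div, div_le_iff₀ this]
    have hk0 : (0 : ℝ) ≤ k := by positivity
    push_cast
    nlinarith [mul_nonneg hk0 hk0, mul_nonneg (mul_nonneg hk0 hk0) hk0]

theorem abs_factor_sub_exp_le {m : ℕ} (hm : 0 < m) (k : ℕ) :
    |((m : ℝ) - k) / (m + k + 1) - Real.exp (-(2 * (k + 1) / m))|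
      ≤ 4 * (k + 1) ^ 2 / m ^ 2 + 1 / m := by
  have hm' : (0 : ℝ) < m := by exact_mod_cast hm
  have hk0 : (0 : ℝ) ≤ k := by positivity
  set u : ℝ := 2 * (k + 1) / m with hu
  have hu0 : 0 ≤ u := by positivity
  have hlow : 1 - u ≤ Real.exp (-u) := Real.one_sub_le_exp_neg u
  have hupp : Real.exp (-u) ≤ 1 - u + u ^ 2 / 2 := by
    have h1 := Real.quadratic_le_exp_of_nonneg hu0
    have h2 : Real.exp (-u) * Real.exp u = 1 := by rw [← Real.exp_add]; simp
    have h3 : 0 < 1 - u + u ^ 2 / 2 := by nlinarith [sq_nonneg (u - 1)]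
    have h4 : 1 ≤ (1 - u + u ^ 2 / 2) * (1 + u + u ^ 2 / 2) := by nlinarith [sq_nonneg (u ^ 2)]
    have h5 := mul_le_mul_of_nonneg_left h1 h3.le
    refine le_of_mul_le_mul_right ?_ (Real.exp_pos u)
    linarith
  have hx : ((m : ℝ) - k) / (m + k + 1)
      = 1 - u + (2 * (k + 1) ^ 2 + m) / (m * (m + k + 1)) := by
    rw [hu]
    field_simp
    ring
  have hr0 : 0 ≤ (2 * ((k : ℝ) + 1) ^ 2 + m) / (m * (m + k + 1)) := by positivity
  have hr : (2 * ((k : ℝ) + 1) ^ 2 + m) / (m * (m + k + 1))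
      ≤ 2 * (k + 1) ^ 2 / m ^ 2 + 1 / m := by
    calc
      _ ≤ (2 * ((k : ℝ) + 1) ^ 2 + m) / (m * m) := by gcongr; linarith
      _ = _ := by field_simp
  have hu2 : u ^ 2 / 2 = 2 * ((k : ℝ) + 1) ^ 2 / m ^ 2 := by
    rw [hu]
    field_simp
  have hpos : 0 ≤ 2 * ((k : ℝ) + 1) ^ 2 / m ^ 2 := by positivity
  have h4 : 4 * ((k : ℝ) + 1) ^ 2 / m ^ 2 = 2 * (2 * ((k : ℝ) + 1) ^ 2 / m ^ 2) := by ring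
  have hinv : (0 : ℝ) ≤ 1 / m := by positivity
  rw [hx, h4, abs_le]
  constructor <;> linarith

theorem abs_centralRatio_sub_exp_le {m k : ℕ} (hm : 0 < m) (hk : k ≤ m + 1) :
    |centralRatio m k - Real.exp (-((k : ℝ) * (k + 1) / m))| ≤ 9 * k / m := by
  have hm' : (0 : ℝ) < m := by exact_mod_cast hm
  have hm1 : (1 : ℝ) ≤ m := by exact_mod_cast hm
  induction k with
  | zero => simp [centralRatio]
  | succ k ih =>
    have ih := ih (by omega)
    have ha0 : 0 ≤ centralRatio m k := centralRatio_nonneg (by omega)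
    have ha := centralRatio_mul_le (m := m) (k := k) (by omega)
    have hf := abs_factor_sub_exp_le hm k
    have he : Real.exp (-(((k + 1 : ℕ) : ℝ) * ((k + 1 : ℕ) + 1) / m))
        = Real.exp (-((k : ℝ) * (k + 1) / m)) * Real.exp (-(2 * (k + 1) / m)) := by
      rw [← Real.exp_add]
      congr 1
      push_cast
      ring
    rw [he, centralRatio_succ]
    set a := centralRatio m k
    set x := ((m : ℝ) - k) / (m + k + 1)
    set b := Real.exp (-((k : ℝ) * (k + 1) / m))
    set y := Real.exp (-(2 * ((k : ℝ) + 1) / m))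
    have hy0 : 0 ≤ y := (Real.exp_pos _).le
    have hy1 : y ≤ 1 := Real.exp_le_one_iff.2 (neg_nonpos.2 (by positivity))
    have ha1 : a ≤ 1 := by
      refine le_of_mul_le_mul_right ?_ hm'
      nlinarith [mul_nonneg ha0 (sq_nonneg (k : ℝ))]
    have hak : a * ((k : ℝ) + 1) ^ 2 ≤ 2 * m := by
      have : ((k : ℝ) + 1) ^ 2 ≤ 2 * (m + (k : ℝ) ^ 2) := by nlinarith [sq_nonneg ((k : ℝ) - 1)]
      nlinarith [mul_le_mul_of_nonneg_left this ha0]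
    have hstep : a * |x - y| ≤ 9 / m := by
      calc
        a * |x - y| ≤ a * (4 * (k + 1) ^ 2 / m ^ 2 + 1 / m) := mul_le_mul_of_nonneg_left hf ha0
        _ = 4 * (a * (k + 1) ^ 2) / m ^ 2 + a / m := by ring
        _ ≤ 4 * (2 * m) / m ^ 2 + 1 / m := by gcongr
        _ = 9 / m := by field_simp; norm_num
    calc
      |a * x - b * y| = |a * (x - y) + (a - b) * y| := by congr 1; ring
      _ ≤ a * |x - y| + |a - b| * y := by
        refine (abs_add_le _ _).trans_eq ?_
        rw [abs_mul, abs_mul, abs_of_nonneg ha0, abs_of_nonneg hy0]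
      _ ≤ 9 / m + |a - b| := by
        gcongr
        exact mul_le_of_le_one_right (abs_nonneg _) hy1
      _ ≤ 9 / m + 9 * k / m := by gcongr
      _ = _ := by push_cast; ring

theorem abs_exp_neg_sub_exp_neg_le {x y : ℝ} (hx : 0 ≤ x) (hxy : x ≤ y) :
    |Real.exp (-y) - Real.exp (-x)| ≤ y - x := by
  have h1 : Real.exp (-y) ≤ Real.exp (-x) := Real.exp_le_exp.2 (by linarith)
  have h2 := Real.one_sub_le_exp_neg (y - x)
  have h3 : Real.exp (-y) = Real.exp (-x) * Real.exp (-(y - x)) := by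
    rw [← Real.exp_add]
    congr 1
    ring
  have h4 : Real.exp (-x) ≤ 1 := Real.exp_le_one_iff.2 (by linarith)
  have h5 := Real.exp_pos (-x)
  rw [abs_sub_comm, abs_of_nonneg (by linarith), h3]
  nlinarith

theorem exists_index_threshold (m : ℕ) {t : ℝ} (ht : 0 < t) :
    ∃ k ≤ m + 1, (k : ℝ) * (k - 1) ≤ m * t ∧ ((m : ℝ) * t < k * (k + 1) ∨ k = m + 1) ∧
      ∀ j ≤ m, (j : ℝ) * (j + 1) ≤ m * t ↔ j < k := by
  classical
  have hex : ∃ k : ℕ, (m : ℝ) * t < k * (k + 1) ∨ k = m + 1 := ⟨m + 1, Or.inr rfl⟩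
  have hlt : ∀ j < Nat.find hex, (j : ℝ) * (j + 1) ≤ m * t := fun j hj =>
    not_lt.1 fun h => Nat.find_min hex hj (Or.inl h)
  refine ⟨Nat.find hex, Nat.find_min' hex (Or.inr rfl), ?_, Nat.find_spec hex,
    fun j hj => ⟨fun h => ?_, hlt j⟩⟩
  · rcases Nat.eq_zero_or_pos (Nat.find hex) with h0 | h0
    · rw [h0]
      have : (0 : ℝ) ≤ m * t := by positivity
      simpa using this
    · have h := hlt (Nat.find hex - 1) (by omega)
      rw [Nat.cast_sub h0] at h
      push_cast at h
      linarith
  · by_contra! hkj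
    rcases Nat.find_spec hex with h' | h'
    · have : (Nat.find hex : ℝ) ≤ j := by exact_mod_cast hkj
      have : (Nat.find hex : ℝ) * (Nat.find hex + 1) ≤ j * (j + 1) := by gcongr
      linarith
    · omega

theorem div_le_two_mul_max_div_sqrt {m k : ℕ} (hm : 0 < m) {t : ℝ}
    (h : (k : ℝ) * (k - 1) ≤ m * t) :
    (k : ℝ) / m ≤ 2 * max 1 √t / √m := by
  have hm1 : (1 : ℝ) ≤ m := by exact_mod_cast hm
  have hs : 1 ≤ √(m : ℝ) := Real.one_le_sqrt.2 hm1
  have hsq : √(m : ℝ) * √(m : ℝ) = m := Real.mul_self_sqrt (by positivity)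
  have hk : (k : ℝ) - 1 ≤ √m * √t := by
    rw [← Real.sqrt_mul (by positivity)]
    rcases Nat.eq_zero_or_pos k with rfl | hk
    · have := Real.sqrt_nonneg ((m : ℝ) * t)
      push_cast
      linarith
    · have hk1 : (1 : ℝ) ≤ k := by exact_mod_cast hk
      refine Real.le_sqrt_of_sq_le ?_
      nlinarith
  have h1 : √(m : ℝ) * √t ≤ √m * max 1 √t := by gcongr; exact le_max_right _ _
  have h2 : 1 ≤ √(m : ℝ) * max 1 √t := one_le_mul_of_one_le_of_one_le hs (le_max_left _ _)
  rw [div_le_div_iff₀ (by positivity) (by positivity)]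
  calc
    (k : ℝ) * √m ≤ (2 * (√m * max 1 √t)) * √m := by gcongr; linarith
    _ = 2 * max 1 √t * (√m * √m) := by ring
    _ = 2 * max 1 √t * m := by rw [hsq]

theorem abs_centralRatio_sub_exp_neg_le {m k : ℕ} (hm : 0 < m) (hk : k ≤ m + 1) {t : ℝ}
    (ht : 0 < t) (hlow : (k : ℝ) * (k - 1) ≤ m * t)
    (hupp : (m : ℝ) * t < k * (k + 1) ∨ k = m + 1) :
    |centralRatio m k - Real.exp (-t)| ≤ 22 * max 1 √t / √m := by
  have hm' : (0 : ℝ) < m := by exact_mod_cast hm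
  rcases hupp with hupp | rfl
  · have htu : t ≤ (k : ℝ) * (k + 1) / m := by
      rw [le_div_iff₀ hm']
      linarith
    have hgap : (k : ℝ) * (k + 1) / m - t ≤ 2 * k / m := by
      rw [sub_le_iff_le_add, div_add' _ _ _ hm'.ne']
      gcongr
      linarith
    have h1 := abs_centralRatio_sub_exp_le hm hk
    have h2 := abs_exp_neg_sub_exp_neg_le ht.le htu
    have h3 := div_le_two_mul_max_div_sqrt hm hlow
    calc
      _ ≤ 9 * (k : ℝ) / m + 2 * k / m :=
        (abs_sub_le _ _ _).trans (add_le_add h1 (h2.trans hgap))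
      _ = 11 * ((k : ℝ) / m) := by ring
      _ ≤ 11 * (2 * max 1 √t / √m) := by gcongr
      _ = _ := by ring
  · have hmt : (m : ℝ) ≤ t := by
      push_cast at hlow
      nlinarith
    have he : Real.exp (-t) ≤ 1 := Real.exp_le_one_iff.2 (by linarith)
    have hs : √(m : ℝ) ≤ max 1 √t := (Real.sqrt_le_sqrt hmt).trans (le_max_right _ _)
    rw [centralRatio_succ_self, zero_sub, abs_neg, abs_of_pos (Real.exp_pos _)]
    refine he.trans ?_
    rw [le_div_iff₀ (by positivity)]
    linarith [Real.sqrt_nonneg (m : ℝ)]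

/-- Proposition 4.1 (small): upper bound for small `t`. -/
theorem bernoulli_laplace_small_t :
    ∃ C : ℝ, ∀ n : ℕ, Even n → 0 < n → ∀ t : ℝ, 0 < t →
      |PBL n t - (1 - Real.exp (-t))| ≤ C * max 1 (Real.sqrt t) / Real.sqrt n := by
  refine ⟨22 * √2, fun n hn hpos t ht => ?_⟩
  obtain ⟨m, rfl⟩ := even_iff_exists_two_mul.1 hn
  have hm : 0 < m := by omega
  obtain ⟨k, hk, hlow, hupp, hiff⟩ := exists_index_threshold m ht
  rw [PBL_eq_one_sub_centralRatio hm hk hiff, sub_sub_sub_cancel_left, abs_sub_comm]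
  refine (abs_centralRatio_sub_exp_neg_le hm hk ht hlow hupp).trans_eq ?_
  have hm' : (0 : ℝ) < m := by exact_mod_cast hm
  push_cast
  rw [Real.sqrt_mul (by norm_num)]
  field_simp
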